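/- Let N = 2 and q ∈ ℂ*. The restriction of the natural surjection π : O(GL_q) → O(SL_q) maps the subalgebra ℂ⟨x_{21}²/det_q, x_{21}x_{22}/det_q, x_{22}²/det_q⟩ of O(GL_q) isomorphically onto the subalgebra ℂ⟨c², cd, d²⟩ of O(SL_q). -/

import Mathlib

open TensorProduct

noncomputable section

/-- Number of inversions (the length) of a permutation of `Fin t`. -/
def invCount {t : ℕ} (σ : Equiv.Perm (Fin t)) : ℕ :=
  (Finset.univ.filter fun p : Fin t × Fin t => p.1 < p.2 ∧ σ p.2 < σ p.1).card

/-- The principal quantum minor `[I|I]` of the matrix of generators `x`. -/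
def qMinor {A : Type} [CommRing A] {M : Type} [Ring M] [Algebra A M] {N : ℕ}
    (q : A) (x : Fin N → Fin N → M) (I : Finset (Fin N)) : M :=
  ∑ σ : Equiv.Perm (Fin I.card),
    ((-q) ^ invCount σ) •
      ((List.finRange I.card).map fun k =>
        x ((I.orderIsoOfFin rfl) k).1 ((I.orderIsoOfFin rfl) (σ k)).1).prod

/-- The quantum determinant. -/
def qdet {A : Type} [CommRing A] {M : Type} [Ring M] [Algebra A M] {N : ℕ}
    (q : A) (x : Fin N → Fin N → M) : M :=
  qMinor q x Finset.univ

/-- `w(I)`: the sum of the elements of `I` (with `{1, …, N}` indexing). -/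
def wtSet {N : ℕ} (I : Finset (Fin N)) : ℕ := ∑ j ∈ I, (j.1 + 1)

/-- The weighted sum `τ_i` of principal quantum minors of size `i`. -/
def tauCoinv {A : Type} [CommRing A] {M : Type} [Ring M] [Algebra A M] {N : ℕ}
    (q qinv : A) (x : Fin N → Fin N → M) (i : ℕ) : M :=
  ∑ I ∈ Finset.univ.filter (fun I : Finset (Fin N) => I.card = i),
    qinv ^ (2 * wtSet I) • qMinor q x I

/-- The sum `σ_i` of all principal quantum minors of size `i`. -/
def sigmaCoinv {A : Type} [CommRing A] {M : Type} [Ring M] [Algebra A M] {N : ℕ}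
    (q : A) (x : Fin N → Fin N → M) (i : ℕ) : M :=
  ∑ I ∈ Finset.univ.filter (fun I : Finset (Fin N) => I.card = i), qMinor q x I

/-- The right adjoint coaction `β(h) = Σ h₂ ⊗ S(h₁)h₃`. -/
def adjBeta {A : Type} [CommRing A] {M G : Type} [Ring M] [Algebra A M] [Ring G] [Algebra A G]
    (ΔM : M →ₐ[A] M ⊗[A] M) (ι : M →ₐ[A] G) (St : G →ₗ[A] G) : M →ₗ[A] M ⊗[A] G :=
  TensorProduct.map LinearMap.id (LinearMap.mul' A G) ∘ₗ
  (TensorProduct.assoc A M G G).toLinearMap ∘ₗ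
  TensorProduct.map
    ((TensorProduct.comm A G M).toLinearMap ∘ₗ
      TensorProduct.map (St ∘ₗ ι.toLinearMap) LinearMap.id)
    ι.toLinearMap ∘ₗ
  TensorProduct.map ΔM.toLinearMap LinearMap.id ∘ₗ ΔM.toLinearMap

/-- The right coaction `α(h) = Σ h₂ ⊗ h₃S(h₁)`. -/
def adjAlpha {A : Type} [CommRing A] {M G : Type} [Ring M] [Algebra A M] [Ring G] [Algebra A G]
    (ΔM : M →ₐ[A] M ⊗[A] M) (ι : M →ₐ[A] G) (St : G →ₗ[A] G) : M →ₗ[A] M ⊗[A] G :=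
  TensorProduct.map LinearMap.id (LinearMap.mul' A G) ∘ₗ
  TensorProduct.map LinearMap.id (TensorProduct.comm A G G).toLinearMap ∘ₗ
  (TensorProduct.assoc A M G G).toLinearMap ∘ₗ
  TensorProduct.map
    ((TensorProduct.comm A G M).toLinearMap ∘ₗ
      TensorProduct.map (St ∘ₗ ι.toLinearMap) LinearMap.id)
    ι.toLinearMap ∘ₗ
  TensorProduct.map ΔM.toLinearMap LinearMap.id ∘ₗ ΔM.toLinearMap

/-- The co-orbit map associated to a point `e = ev_ξ` and a coaction `b`. -/
def coorbit {A : Type} [CommRing A] {M G : Type} [Ring M] [Algebra A M] [Ring G] [Algebra A G]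
    (e : M →ₐ[A] A) (b : M →ₗ[A] M ⊗[A] G) : M →ₗ[A] G :=
  (TensorProduct.lid A G).toLinearMap ∘ₗ TensorProduct.map e.toLinearMap LinearMap.id ∘ₗ b

/-- The left coaction `λ_D = (π_D ⊗ id) ∘ Δ` of a quotient Hopf algebra. -/
def leftCoact {A : Type} [CommRing A] {G D : Type} [Ring G] [Algebra A G]
    [CommRing D] [Algebra A D]
    (πD : G →ₐ[A] D) (ΔG : G →ₐ[A] G ⊗[A] G) : G →ₗ[A] D ⊗[A] G :=
  TensorProduct.map πD.toLinearMap LinearMap.id ∘ₗ ΔG.toLinearMap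

/-- Coinvariants of the left coaction `λ_D`. -/
def dCoinv {A : Type} [CommRing A] {G D : Type} [Ring G] [Algebra A G]
    [CommRing D] [Algebra A D]
    (πD : G →ₐ[A] D) (ΔG : G →ₐ[A] G ⊗[A] G) : Set G :=
  {f : G | leftCoact πD ΔG f = (1 : D) ⊗ₜ[A] f}

/-- The right coaction `ρ_D = (id ⊗ π_D) ∘ Δ`. -/
def rightCoact {A : Type} [CommRing A] {G D : Type} [Ring G] [Algebra A G]
    [CommRing D] [Algebra A D]
    (πD : G →ₐ[A] D) (ΔG : G →ₐ[A] G ⊗[A] G) : G →ₗ[A] G ⊗[A] D :=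
  TensorProduct.map LinearMap.id πD.toLinearMap ∘ₗ ΔG.toLinearMap

/-- The weight space of weight `ta : D` for the grading induced by `ρ_D`. -/
def weightSpace' {A : Type} [CommRing A] {G D : Type} [Ring G] [Algebra A G]
    [CommRing D] [Algebra A D]
    (πD : G →ₐ[A] D) (ΔG : G →ₐ[A] G ⊗[A] G) (ta : D) : Submodule A G :=
  LinearMap.ker (rightCoact πD ΔG - (TensorProduct.mk A G D).flip ta)

/-- The subcomodule generated by a subset `s` of the comodule `(M, b)`. -/
def comodGen {A : Type} [CommRing A] {M G : Type} [Ring M] [Algebra A M] [Ring G] [Algebra A G]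
    (b : M →ₗ[A] M ⊗[A] G) (s : Set M) : Submodule A M :=
  sInf {W : Submodule A M | s ⊆ W ∧
    ∀ w ∈ W, b w ∈ LinearMap.range (TensorProduct.map W.subtype (LinearMap.id : G →ₗ[A] G))}

theorem qdet_two_eq {M : Type} [Ring M] [Algebra ℂ M] (q : ℂ) (x : Fin 2 → Fin 2 → M) :
    qdet q x = x 0 0 * x 1 1 - q • (x 0 1 * x 1 0) := by
  have key : ∀ e : Fin 2 ≃o (Finset.univ : Finset (Fin 2)), ∀ k, (e k).1 = k := by
    intro e k
    have h01 : (e 0).1 < (e 1).1 := e.strictMono (by decide)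
    fin_cases k
    · change (e 0).1 = 0
      omega
    · change (e 1).1 = 1
      omega
  have main : ∀ e : Fin 2 ≃o (Finset.univ : Finset (Fin 2)),
      (∑ σ : Equiv.Perm (Fin 2), ((-q) ^ invCount σ) •
        ((List.finRange 2).map fun k => x (e k).1 (e (σ k)).1).prod) =
      x 0 0 * x 1 1 - q • (x 0 1 * x 1 0) := by
    intro e
    have huniv : (Finset.univ : Finset (Equiv.Perm (Fin 2))) = {1, Equiv.swap 0 1} := by decide
    have h1 : invCount (1 : Equiv.Perm (Fin 2)) = 0 := by decide
    have h2 : invCount (Equiv.swap 0 1 : Equiv.Perm (Fin 2)) = 1 := by decide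
    have hne : (1 : Equiv.Perm (Fin 2)) ≠ Equiv.swap 0 1 := by decide
    rw [huniv, Finset.sum_pair hne, h1, h2]
    simp [key, List.finRange_succ, sub_eq_add_neg]
  exact main _

section QuantumPlane

variable {A : Type} [Ring A] [Algebra ℂ A] {q : ℂ} {c d u : A}

theorem pow_mul_pow_comm_smul (hq : q ≠ 0) (hcd : c * d = q • (d * c)) (i j : ℕ) :
    d ^ j * c ^ i = (q⁻¹) ^ (i * j) • (c ^ i * d ^ j) := by
  have h1 : d * c = q⁻¹ • (c * d) := by rw [hcd, smul_smul, inv_mul_cancel₀ hq, one_smul]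
  have h2 : ∀ i : ℕ, d * c ^ i = (q⁻¹) ^ i • (c ^ i * d) := by
    intro i
    induction i with
    | zero => simp
    | succ i ih =>
      rw [pow_succ, ← mul_assoc, ih, smul_mul_assoc, mul_assoc, h1, mul_smul_comm, smul_smul,
        ← pow_succ, mul_assoc]
  induction j with
  | zero => simp
  | succ j ih =>
    rw [pow_succ, mul_assoc, h2, mul_smul_comm, ← mul_assoc, ih, smul_mul_assoc, smul_smul,
      mul_assoc, ← pow_add]
    congr 2
    ring

theorem even_monomial_mul (hq : q ≠ 0) (hcd : c * d = q • (d * c)) (huc : Commute u c)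
    (hud : Commute u d) (i j k i' j' k' : ℕ) :
    (c ^ i * d ^ j * u ^ k) * (c ^ i' * d ^ j' * u ^ k') =
      (q⁻¹) ^ (i' * j) • (c ^ (i + i') * d ^ (j + j') * u ^ (k + k')) := by
  have hu : u ^ k * (c ^ i' * d ^ j') = c ^ i' * d ^ j' * u ^ k :=
    ((huc.pow_pow k i').mul_right (hud.pow_pow k j')).eq
  calc (c ^ i * d ^ j * u ^ k) * (c ^ i' * d ^ j' * u ^ k')
      = c ^ i * d ^ j * (u ^ k * (c ^ i' * d ^ j')) * u ^ k' := by simp only [mul_assoc]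
    _ = c ^ i * (d ^ j * c ^ i') * d ^ j' * (u ^ k * u ^ k') := by
        rw [hu]; simp only [mul_assoc]
    _ = _ := by
        rw [pow_mul_pow_comm_smul hq hcd, pow_add, pow_add, pow_add]
        simp only [mul_smul_comm, smul_mul_assoc, mul_assoc]

/-- The subalgebra generated by `c²u`, `cdu`, `d²u` is spanned by the monomials `cⁱdʲuᵏ` with
`i + j = 2k`. -/
theorem adjoin_le_span_even_monomials (hq : q ≠ 0) (hcd : c * d = q • (d * c))
    (huc : Commute u c) (hud : Commute u d) :
    Subalgebra.toSubmodule (Algebra.adjoin ℂ ({c ^ 2 * u, c * d * u, d ^ 2 * u} : Set A)) ≤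
      Submodule.span ℂ {m | ∃ i j k : ℕ, i + j = 2 * k ∧ m = c ^ i * d ^ j * u ^ k} := by
  rw [Algebra.adjoin_eq_span, Submodule.span_le]
  have h : ∀ y ∈ Submonoid.closure ({c ^ 2 * u, c * d * u, d ^ 2 * u} : Set A),
      ∃ (r : ℂ) (i j k : ℕ), i + j = 2 * k ∧ y = r • (c ^ i * d ^ j * u ^ k) := by
    intro y hy
    induction hy using Submonoid.closure_induction with
    | mem y hy =>
      rcases hy with rfl | rfl | rfl
      · exact ⟨1, 2, 0, 1, rfl, by simp⟩
      · exact ⟨1, 1, 1, 1, rfl, by simp⟩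
      · exact ⟨1, 0, 2, 1, rfl, by simp⟩
    | one => exact ⟨1, 0, 0, 0, rfl, by simp⟩
    | mul y z _ _ hy hz =>
      obtain ⟨r, i, j, k, h, rfl⟩ := hy
      obtain ⟨r', i', j', k', h', rfl⟩ := hz
      refine ⟨r * r' * (q⁻¹) ^ (i' * j), i + i', j + j', k + k', by omega, ?_⟩
      rw [smul_mul_smul_comm, even_monomial_mul hq hcd huc hud, smul_smul]
  intro y hy
  obtain ⟨r, i, j, k, hijk, rfl⟩ := h y hy
  exact Submodule.smul_mem _ _ (Submodule.subset_span ⟨i, j, k, hijk, rfl⟩)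

end QuantumPlane

section Representation

/-- The operator `e_{m,n} ↦ e_{m+1,n}`. -/
def planeC : Module.End ℂ (ℕ × ℤ →₀ ℂ) :=
  Finsupp.lsum ℂ fun p => Finsupp.lsingle (p.1 + 1, p.2)

/-- The operator `e_{m,n} ↦ q⁻ᵐ e_{m,n+1}`. -/
def planeD (q : ℂ) : Module.End ℂ (ℕ × ℤ →₀ ℂ) :=
  Finsupp.lsum ℂ fun p => (q⁻¹) ^ p.1 • Finsupp.lsingle (p.1, p.2 + 1)

/-- The operator `e_{m,n} ↦ qᵐ e_{m,n-1}`, inverse to `planeD`. -/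
def planeA (q : ℂ) : Module.End ℂ (ℕ × ℤ →₀ ℂ) :=
  Finsupp.lsum ℂ fun p => q ^ p.1 • Finsupp.lsingle (p.1, p.2 - 1)

@[simp]
theorem planeC_single (m : ℕ) (n : ℤ) (r : ℂ) :
    planeC (Finsupp.single (m, n) r) = Finsupp.single (m + 1, n) r := by
  simp [planeC]

@[simp]
theorem planeD_single (q : ℂ) (m : ℕ) (n : ℤ) (r : ℂ) :
    planeD q (Finsupp.single (m, n) r) = Finsupp.single (m, n + 1) ((q⁻¹) ^ m * r) := by
  simp [planeD]

@[simp]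
theorem planeA_single (q : ℂ) (m : ℕ) (n : ℤ) (r : ℂ) :
    planeA q (Finsupp.single (m, n) r) = Finsupp.single (m, n - 1) (q ^ m * r) := by
  simp [planeA]

theorem plane_end_ext {f g : Module.End ℂ (ℕ × ℤ →₀ ℂ)}
    (h : ∀ m n, f (Finsupp.single (m, n) 1) = g (Finsupp.single (m, n) 1)) : f = g :=
  Finsupp.lhom_ext' fun p => LinearMap.ext_ring (h p.1 p.2)

theorem planeA_mul_planeD {q : ℂ} (hq : q ≠ 0) : planeA q * planeD q = 1 :=
  plane_end_ext fun m n => by simp [hq]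

theorem planeD_mul_planeA {q : ℂ} (hq : q ≠ 0) : planeD q * planeA q = 1 :=
  plane_end_ext fun m n => by simp [hq]

theorem planeC_mul_planeD {q : ℂ} (hq : q ≠ 0) :
    planeC * planeD q = q • (planeD q * planeC) :=
  plane_end_ext fun m n => by
    simp only [Module.End.mul_apply, LinearMap.smul_apply, planeC_single, planeD_single,
      Finsupp.smul_single, smul_eq_mul]
    congr 1
    rw [pow_succ]
    field_simp

theorem planeA_mul_planeC (q : ℂ) : planeA q * planeC = q • (planeC * planeA q) :=
  plane_end_ext fun m n => by simp [pow_succ, mul_comm]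

theorem planeC_pow_mul_planeD_pow_apply (q : ℂ) (i j : ℕ) :
    (planeC ^ i * planeD q ^ j) (Finsupp.single (0, 0) 1) = Finsupp.single (i, (j : ℤ)) 1 := by
  have hD : (planeD q ^ j) (Finsupp.single (0, 0) 1) = Finsupp.single (0, (j : ℤ)) 1 := by
    induction j with
    | zero => simp
    | succ j ih => rw [pow_succ', Module.End.mul_apply, ih]; simp
  rw [Module.End.mul_apply, hD]
  induction i with
  | zero => simp
  | succ i ih => rw [pow_succ', Module.End.mul_apply, ih]; simp

end Representation

/-- A representation sending `c`, `d` to `planeC`, `planeD` and `u` to `1` is faithful on the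
subalgebra generated by `c²u`, `cdu`, `d²u`. -/
theorem injOn_adjoin_of_plane_representation {A : Type} [Ring A] [Algebra ℂ A] {q : ℂ}
    {c d u : A} (hq : q ≠ 0) (hcd : c * d = q • (d * c)) (huc : Commute u c)
    (hud : Commute u d) (ρ : A →ₐ[ℂ] Module.End ℂ (ℕ × ℤ →₀ ℂ)) (hc : ρ c = planeC)
    (hd : ρ d = planeD q) (hu : ρ u = 1) :
    Set.InjOn ρ (Algebra.adjoin ℂ ({c ^ 2 * u, c * d * u, d ^ 2 * u} : Set A)) := by
  let L : (ℕ × ℤ →₀ ℂ) →ₗ[ℂ] A := Finsupp.lsum ℂ fun p =>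
    LinearMap.toSpanSingleton ℂ A (c ^ p.1 * d ^ p.2.toNat * u ^ ((p.1 + p.2.toNat) / 2))
  have hL : ∀ y ∈ Submodule.span ℂ {m | ∃ i j k : ℕ, i + j = 2 * k ∧ m = c ^ i * d ^ j * u ^ k},
      L (ρ y (Finsupp.single (0, 0) 1)) = y := by
    intro y hy
    induction hy using Submodule.span_induction with
    | mem y hy =>
      obtain ⟨i, j, k, hijk, rfl⟩ := hy
      rw [map_mul, map_mul, map_pow, map_pow, map_pow, hc, hd, hu, one_pow, mul_one,
        planeC_pow_mul_planeD_pow_apply]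
      simp [L, hijk]
    | zero => simp
    | add y z _ _ hy hz => rw [map_add, LinearMap.add_apply, map_add, hy, hz]
    | smul r y _ hy => rw [map_smul, LinearMap.smul_apply, map_smul, hy]
  intro y hy z hz h
  have hspan := adjoin_le_span_even_monomials hq hcd huc hud
  rw [← hL y (hspan hy), ← hL z (hspan hz), h]

/-- `N = 2`: `π` maps `ℂ⟨x₂₁²/det_q, x₂₁x₂₂/det_q, x₂₂²/det_q⟩` isomorphically onto
`ℂ⟨c², cd, d²⟩`. -/
theorem restriction_pi_even_quantum_plane
    (q : ℂ) (hq : q ≠ 0)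
    (M G : Type) [Ring M] [Algebra ℂ M] [Ring G] [Algebra ℂ G]
    (x : Fin 2 → Fin 2 → M)
    (hrow : ∀ i j l : Fin 2, j < l → x i j * x i l = (q) • (x i l * x i j))
    (hcol : ∀ i k j : Fin 2, i < k → x i j * x k j = (q) • (x k j * x i j))
    (hanti : ∀ i k j l : Fin 2, i < k → j < l → x i l * x k j = x k j * x i l)
    (hdiag : ∀ i k j l : Fin 2, i < k → j < l →
      x i j * x k l - x k l * x i j = ((q) - (q⁻¹)) • (x i l * x k j))
    (hgen : Algebra.adjoin ℂ (Set.range fun p : Fin 2 × Fin 2 => x p.1 p.2) = ⊤)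
    (hfree : ∀ (B : Type) [Ring B] [Algebra ℂ B] (y : Fin 2 → Fin 2 → B),
      (∀ i j l : Fin 2, j < l → y i j * y i l = (q) • (y i l * y i j)) →
      (∀ i k j : Fin 2, i < k → y i j * y k j = (q) • (y k j * y i j)) →
      (∀ i k j l : Fin 2, i < k → j < l → y i l * y k j = y k j * y i l) →
      (∀ i k j l : Fin 2, i < k → j < l →
        y i j * y k l - y k l * y i j = ((q) - (q⁻¹)) • (y i l * y k j)) →
      ∃! φ : M →ₐ[ℂ] B, ∀ i j, φ (x i j) = y i j)
    (ι : M →ₐ[ℂ] G) (dInv : G)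
    (hd1 : ι (qdet (q) x) * dInv = 1)
    (hd2 : dInv * ι (qdet (q) x) = 1)
    (hgenG : Algebra.adjoin ℂ
      (Set.range (fun p : Fin 2 × Fin 2 => ι (x p.1 p.2)) ∪ {dInv}) = ⊤)
    (hfreeG : ∀ (B : Type) [Ring B] [Algebra ℂ B] (φ : M →ₐ[ℂ] B) (u : B),
      φ (qdet (q) x) * u = 1 → u * φ (qdet (q) x) = 1 →
      ∃! ψ : G →ₐ[ℂ] B, ψ.comp ι = φ)
    (ΔM : M →ₐ[ℂ] M ⊗[ℂ] M)
    (hΔM : ∀ i j, ΔM (x i j) = ∑ k, x i k ⊗ₜ[ℂ] x k j)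
    (ΔG : G →ₐ[ℂ] G ⊗[ℂ] G)
    (hΔG : ∀ m, ΔG (ι m) = Algebra.TensorProduct.map ι ι (ΔM m))
    (εG : G →ₐ[ℂ] ℂ)
    (hεG : ∀ i j, εG (ι (x i j)) = if i = j then 1 else 0)
    (St : G →ₗ[ℂ] G)
    (hS1 : LinearMap.mul' ℂ G ∘ₗ TensorProduct.map St LinearMap.id ∘ₗ ΔG.toLinearMap
      = Algebra.linearMap ℂ G ∘ₗ εG.toLinearMap)
    (hS2 : LinearMap.mul' ℂ G ∘ₗ TensorProduct.map LinearMap.id St ∘ₗ ΔG.toLinearMap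
      = Algebra.linearMap ℂ G ∘ₗ εG.toLinearMap)
    (SL : Type) [Ring SL] [Algebra ℂ SL] (π : G →ₐ[ℂ] SL)
    (hπsurj : Function.Surjective ⇑π)
    (hπdet : π (ι (qdet q x)) = 1)
    (hfreeSL : ∀ (B : Type) [Ring B] [Algebra ℂ B] (φ : G →ₐ[ℂ] B),
      φ (ι (qdet q x)) = 1 → ∃! ψ : SL →ₐ[ℂ] B, ψ.comp π = φ)
 :
    Set.InjOn ⇑π ↑(Algebra.adjoin ℂ
      ({ι (x 1 0) ^ 2 * dInv, ι (x 1 0) * ι (x 1 1) * dInv, ι (x 1 1) ^ 2 * dInv} : Set G))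
    ∧ ⇑π '' ↑(Algebra.adjoin ℂ
      ({ι (x 1 0) ^ 2 * dInv, ι (x 1 0) * ι (x 1 1) * dInv, ι (x 1 1) ^ 2 * dInv} : Set G))
      = ↑(Algebra.adjoin ℂ
          ({π (ι (x 1 0)) ^ 2, π (ι (x 1 0)) * π (ι (x 1 1)), π (ι (x 1 1)) ^ 2} : Set SL)) := by
  have hdet := qdet_two_eq q x
  have hcd : x 1 0 * x 1 1 = q • (x 1 1 * x 1 0) := hrow 1 0 1 (by decide)
  have hac : x 0 0 * x 1 0 = q • (x 1 0 * x 0 0) := hcol 0 1 0 (by decide)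
  have hbd : x 0 1 * x 1 1 = q • (x 1 1 * x 0 1) := hcol 0 1 1 (by decide)
  have hbc : x 0 1 * x 1 0 = x 1 0 * x 0 1 := hanti 0 1 0 1 (by decide) (by decide)
  have had : x 0 0 * x 1 1 - x 1 1 * x 0 0 = (q - q⁻¹) • (x 0 1 * x 1 0) :=
    hdiag 0 1 0 1 (by decide) (by decide)
  have hDc : Commute (qdet q x) (x 1 0) := by
    have h : x 1 0 * (x 0 0 * x 1 1) = x 0 0 * x 1 1 * x 1 0 := by
      have h1 : q • (x 1 0 * (x 0 0 * x 1 1)) = q • (x 0 0 * x 1 1 * x 1 0) := by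
        rw [← mul_assoc, ← smul_mul_assoc, ← hac, mul_assoc, hcd, mul_smul_comm, mul_assoc]
      exact smul_right_injective _ hq h1
    rw [Commute, SemiconjBy, hdet, sub_mul, mul_sub, h, smul_mul_assoc, mul_smul_comm,
      ← mul_assoc (x 1 0) (x 0 1), ← hbc]
  have hDd : Commute (qdet q x) (x 1 1) := by
    have h1 : q • (x 1 1 * (x 0 1 * x 1 0)) = q⁻¹ • (x 0 1 * x 1 0 * x 1 1) := by
      rw [← mul_assoc, ← smul_mul_assoc, ← hbd, mul_assoc, mul_assoc, hcd, mul_smul_comm,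
        smul_smul, inv_mul_cancel₀ hq, one_smul]
    have h2 : x 1 1 * x 0 0 = x 0 0 * x 1 1 - (q - q⁻¹) • (x 0 1 * x 1 0) := by
      rw [← had, sub_sub_cancel]
    rw [Commute, SemiconjBy, hdet, mul_sub, ← mul_assoc, h2, mul_smul_comm, h1, sub_mul,
      sub_mul, smul_mul_assoc, smul_mul_assoc, sub_smul]
    abel
  have hinv : ∀ y, Commute (qdet q x) y → Commute dInv (ι y) := fun y hy =>
    (show Commute (↑(⟨ι (qdet q x), dInv, hd1, hd2⟩ : Gˣ)) (ι y) from
      hy.map ι).units_inv_left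
  have hπu : π dInv = 1 := by
    have h := congrArg π hd1
    rwa [map_mul, hπdet, one_mul, map_one] at h
  obtain ⟨φ, hφ, -⟩ := hfree (Module.End ℂ (ℕ × ℤ →₀ ℂ))
    ![![planeA q, 0], ![planeC, planeD q]]
    (by
      intro i j l hjl
      obtain ⟨rfl, rfl⟩ : j = 0 ∧ l = 1 := by omega
      fin_cases i
      · simp
      · simpa using planeC_mul_planeD hq)
    (by
      intro i k j hik
      obtain ⟨rfl, rfl⟩ : i = 0 ∧ k = 1 := by omega
      fin_cases j
      · simpa using planeA_mul_planeC q
      · simp)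
    (by
      intro i k j l hik hjl
      obtain ⟨rfl, rfl⟩ : i = 0 ∧ k = 1 := by omega
      obtain ⟨rfl, rfl⟩ : j = 0 ∧ l = 1 := by omega
      simp)
    (by
      intro i k j l hik hjl
      obtain ⟨rfl, rfl⟩ : i = 0 ∧ k = 1 := by omega
      obtain ⟨rfl, rfl⟩ : j = 0 ∧ l = 1 := by omega
      simp [planeA_mul_planeD hq, planeD_mul_planeA hq])
  have hφdet : φ (qdet q x) = 1 := by
    rw [hdet, map_sub, map_smul, map_mul, map_mul, hφ, hφ, hφ, hφ]
    simp [planeA_mul_planeD hq]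
  obtain ⟨ψ, hψ, -⟩ := hfreeG (Module.End ℂ (ℕ × ℤ →₀ ℂ)) φ 1
    (by rw [hφdet, mul_one]) (by rw [hφdet, mul_one])
  have hψι : ∀ m, ψ (ι m) = φ m := fun m => DFunLike.congr_fun hψ m
  obtain ⟨χ, hχ, -⟩ := hfreeSL (Module.End ℂ (ℕ × ℤ →₀ ℂ)) ψ (by rw [hψι, hφdet])
  have hχπ : ∀ g, χ (π g) = ψ g := fun g => DFunLike.congr_fun hχ g
  constructor
  · have h := injOn_adjoin_of_plane_representation (c := ι (x 1 0)) (d := ι (x 1 1)) (u := dInv)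
      hq (by rw [← map_mul, hcd, map_smul, map_mul]) (hinv _ hDc) (hinv _ hDd) ψ
      (by rw [hψι, hφ]; rfl) (by rw [hψι, hφ]; rfl)
      (by rw [← hχπ, hπu, map_one])
    intro y hy z hz hyz
    exact h hy hz (by rw [← hχπ, ← hχπ, hyz])
  · rw [← Subalgebra.coe_map, AlgHom.map_adjoin]
    simp [Set.image_insert_eq, hπu]
end
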